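/- Let G be a connected, locally finite, infinite graph with infinite motion and subquadratic growth, i.e., for some (equivalently, every) vertex v one has lim_{n→∞} |B_v(n)|/n² = 0. Then G admits a distinguishing 2-coloring one of whose color classes W satisfies δ_x(W) = 0 for every vertex x; in particular G is 2-distinguishable with density zero. -/

import Mathlib

open Filter SimpleGraph

/-- The ball of radius `n` around `v`: all vertices at distance at most `n` from `v`. -/
def gball {V : Type*} (G : SimpleGraph V) (v : V) (n : ℕ) : Set V :=
  {x | G.dist v x ≤ n}

/-- The sphere of radius `n` around `v`: all vertices at distance exactly `n` from `v`. -/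
def gsphere {V : Type*} (G : SimpleGraph V) (v : V) (n : ℕ) : Set V :=
  {x | G.dist v x = n}

/-- A 2-coloring (vertices colored by `Bool`) is distinguishing if the identity is the
only automorphism preserving it. -/
def Distinguishing {V : Type*} (G : SimpleGraph V) (l : V → Bool) : Prop :=
  ∀ g : G ≃g G, (∀ x, l (g x) = l x) → ∀ x, g x = x

/-- The set `W` has density zero at `v`:
`|B_v(n) ∩ W| / |B_v(n)| → 0` as `n → ∞`. -/
def DensityZeroAt {V : Type*} (G : SimpleGraph V) (W : Set V) (v : V) : Prop :=
  Tendsto (fun n : ℕ => ((gball G v n ∩ W).ncard : ℝ) / ((gball G v n).ncard : ℝ))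
    atTop (nhds 0)

/-- A graph has infinite motion if every nontrivial automorphism moves infinitely many
vertices. -/
def InfiniteMotion {V : Type*} (G : SimpleGraph V) : Prop :=
  ∀ g : G ≃g G, (∃ x, g x ≠ x) → {x : V | g x ≠ x}.Infinite

section Distance

variable {V : Type*} {G : SimpleGraph V}

theorem exists_adj_dist_eq (hconn : G.Connected) {v x : V} {m : ℕ}
    (h : G.dist v x = m + 1) : ∃ y, G.Adj y x ∧ G.dist v y = m := by
  obtain ⟨p, hp⟩ := hconn.exists_walk_length_eq_dist x v
  rw [dist_comm, h] at hp
  cases p with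
  | nil => simp at hp
  | @cons _ y _ hadj q =>
    simp only [Walk.length_cons] at hp
    have hle : G.dist y v ≤ q.length := dist_le q
    have htri := hconn.dist_triangle (u := v) (v := y) (w := x)
    have h1 : G.dist y x = 1 := dist_eq_one_iff_adj.2 hadj.symm
    rw [dist_comm] at hle
    exact ⟨y, hadj.symm, by omega⟩

theorem dist_le_succ_of_adj (hconn : G.Connected) {v x y : V} (h : G.Adj x y) :
    G.dist v y ≤ G.dist v x + 1 := by
  have htri := hconn.dist_triangle (u := v) (v := x) (w := y)
  rwa [dist_eq_one_iff_adj.2 h] at htri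

theorem dist_iso (hconn : G.Connected) (g : G ≃g G) (x y : V) :
    G.dist (g x) (g y) = G.dist x y := by
  have key : ∀ (f : G ≃g G) (a b : V), G.dist (f a) (f b) ≤ G.dist a b := by
    intro f a b
    obtain ⟨p, hp⟩ := hconn.exists_walk_length_eq_dist a b
    rw [← hp, ← Walk.length_map f.toHom p]
    exact dist_le _
  refine le_antisymm (key g x y) ?_
  simpa using key g.symm (g x) (g y)

theorem finite_gball (hconn : G.Connected) (hlf : ∀ x : V, (G.neighborSet x).Finite)
    (v : V) (n : ℕ) : (gball G v n).Finite := by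
  induction n with
  | zero =>
    refine (Set.finite_singleton v).subset fun x hx => ?_
    have : G.dist v x = 0 := Nat.le_zero.1 hx
    exact (hconn.dist_eq_zero_iff.1 this).symm
  | succ n ih =>
    refine (ih.union (ih.biUnion fun x _ => hlf x)).subset fun x hx => ?_
    rcases Nat.lt_or_ge n (G.dist v x) with h | h
    · obtain ⟨y, hy, hd⟩ := exists_adj_dist_eq hconn (le_antisymm hx h)
      exact Or.inr (Set.mem_biUnion (show y ∈ gball G v n from hd.le) hy)
    · exact Or.inl h

theorem exists_vertex_dist_eq [Infinite V] (hconn : G.Connected)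
    (hlf : ∀ x : V, (G.neighborSet x).Finite) (v : V) (n : ℕ) : ∃ x, G.dist v x = n := by
  obtain ⟨x, hx⟩ := (finite_gball hconn hlf v n).exists_notMem
  obtain ⟨d, hd⟩ := Nat.exists_eq_add_of_le (not_le.1 hx).le
  clear hx
  induction d generalizing x with
  | zero => exact ⟨x, hd⟩
  | succ d ih =>
    obtain ⟨y, -, hy⟩ := exists_adj_dist_eq hconn hd
    exact ih y hy

theorem ncard_gball_lt [Infinite V] (hconn : G.Connected)
    (hlf : ∀ x : V, (G.neighborSet x).Finite) (v : V) (n : ℕ) : n < (gball G v n).ncard := by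
  induction n with
  | zero =>
    exact (Set.ncard_pos (finite_gball hconn hlf v 0)).2 ⟨v, by simp [gball]⟩
  | succ n ih =>
    obtain ⟨x, hx⟩ := exists_vertex_dist_eq hconn hlf v (n + 1)
    refine lt_of_le_of_lt ih (Set.ncard_lt_ncard ?_ (finite_gball hconn hlf v _))
    refine ⟨fun y (hy : G.dist v y ≤ n) => hy.trans n.le_succ, fun h => ?_⟩
    have : G.dist v x ≤ n := h hx.le
    omega

theorem ncard_gball_mono (hconn : G.Connected)
    (hlf : ∀ x : V, (G.neighborSet x).Finite) (v : V) :
    Monotone fun n => (gball G v n).ncard := fun _ b hab =>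
  Set.ncard_le_ncard (fun _ hy => le_trans hy hab) (finite_gball hconn hlf v b)

end Distance

section Motion

variable {V : Type*} {G : SimpleGraph V}

theorem dist_lt_of_fixes_sphere (hconn : G.Connected) {v : V} {i : ℕ} (g : G ≃g G)
    (hv : G.dist v (g v) < i) (hfix : ∀ x ∈ gsphere G v i, g x = x) {x : V}
    (hx : G.dist v x < i) : G.dist v (g x) < i := by
  induction hm : G.dist v x generalizing x with
  | zero =>
    rw [← hconn.dist_eq_zero_iff.1 hm]
    exact hv
  | succ m ih =>
    obtain ⟨y, hyx, hy⟩ := exists_adj_dist_eq hconn hm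
    have hgy := ih (by omega) hy
    have hle := dist_le_succ_of_adj hconn (v := v) (g.map_adj_iff.2 hyx)
    refine lt_of_le_of_ne (by omega) fun heq => ?_
    rw [g.injective (hfix (g x) heq)] at heq
    omega

theorem dist_le_of_fixes_sphere (hconn : G.Connected) {v : V} {i : ℕ} (g : G ≃g G)
    (hv : G.dist v (g v) < i) (hfix : ∀ x ∈ gsphere G v i, g x = x) {x : V}
    (hx : G.dist v x ≤ i) : G.dist v (g x) ≤ i := by
  rcases hx.lt_or_eq with h | h
  · exact (dist_lt_of_fixes_sphere hconn g hv hfix h).le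
  · rw [hfix x h]
    exact hx

open Classical in
/-- The automorphism agreeing with `g` on a ball whose boundary sphere is fixed pointwise by `g`,
and with the identity elsewhere. -/
noncomputable def restrictToBall (hconn : G.Connected) {v : V} {i : ℕ} (g : G ≃g G)
    (hv : G.dist v (g v) < i) (hv' : G.dist v (g.symm v) < i)
    (hfix : ∀ x ∈ gsphere G v i, g x = x)
    (hfix' : ∀ x ∈ gsphere G v i, g.symm x = x) : G ≃g G where
  toFun x := if G.dist v x ≤ i then g x else x
  invFun x := if G.dist v x ≤ i then g.symm x else x
  left_inv x := by
    by_cases h : G.dist v x ≤ i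
    · simp [h, dist_le_of_fixes_sphere hconn g hv hfix h]
    · simp [h]
  right_inv x := by
    by_cases h : G.dist v x ≤ i
    · simp [h, dist_le_of_fixes_sphere hconn g.symm hv' hfix' h]
    · simp [h]
  map_rel_iff' := by
    have mixed : ∀ x y : V, G.dist v x ≤ i → ¬ G.dist v y ≤ i →
        (G.Adj (g x) y ↔ G.Adj x y) := by
      intro x y hx hy
      constructor <;> intro h
      · have h1 := dist_le_succ_of_adj hconn (v := v) h
        have h2 := dist_le_of_fixes_sphere hconn g hv hfix hx
        rwa [g.injective (hfix (g x) (show G.dist v (g x) = i by omega))] at h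
      · have h1 := dist_le_succ_of_adj hconn (v := v) h
        rwa [hfix x (show G.dist v x = i by omega)]
    intro x y
    by_cases hx : G.dist v x ≤ i <;> by_cases hy : G.dist v y ≤ i
    · simp [hx, hy, g.map_adj_iff]
    · simpa [hx, hy] using mixed x y hx hy
    · simpa [hx, hy, G.adj_comm] using mixed y x hy hx
    · simp [hx, hy]

theorem fixes_ball_of_fixes_sphere (hconn : G.Connected)
    (hlf : ∀ x : V, (G.neighborSet x).Finite) (hmot : InfiniteMotion G) {v : V} {i : ℕ}
    (g : G ≃g G) (hv : G.dist v (g v) < i) (hfix : ∀ x ∈ gsphere G v i, g x = x) {x : V}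
    (hx : G.dist v x ≤ i) : g x = x := by
  have hv' : G.dist v (g.symm v) < i := by
    rw [← dist_iso hconn g, g.apply_symm_apply, dist_comm]
    exact hv
  have hfix' : ∀ y ∈ gsphere G v i, g.symm y = y := fun y hy =>
    g.injective (by rw [g.apply_symm_apply, hfix y hy])
  by_contra hne
  refine hmot (restrictToBall hconn g hv hv' hfix hfix') ⟨x, by simpa [restrictToBall, hx]⟩
    ((finite_gball hconn hlf v i).subset fun y hy => ?_)
  by_contra hyi
  exact hy (if_neg hyi)

theorem eq_on_ball_of_eq_on_sphere (hconn : G.Connected)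
    (hlf : ∀ x : V, (G.neighborSet x).Finite) (hmot : InfiniteMotion G) {v : V} {i k : ℕ}
    (hki : 2 * k < i) (g h : G ≃g G) (hg : G.dist v (g v) ≤ k) (hh : G.dist v (h v) ≤ k)
    (heq : ∀ x ∈ gsphere G v i, g x = h x) {x : V} (hx : G.dist v x ≤ i) : g x = h x := by
  have key : (g.trans h.symm) x = x := by
    refine fixes_ball_of_fixes_sphere hconn hlf hmot (v := v) (i := i) _ ?_ ?_ hx
    · have h1 : G.dist v (h.symm (g v)) = G.dist (h v) (g v) := by
        rw [← dist_iso hconn h, h.apply_symm_apply]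
      have h2 := hconn.dist_triangle (u := h v) (v := v) (w := g v)
      rw [dist_comm (u := h v) (v := v)] at h2
      change G.dist v (h.symm (g v)) < i
      omega
    · intro y hy
      change h.symm (g y) = y
      rw [heq y hy, h.symm_apply_apply]
  have key : h.symm (g x) = x := key
  rw [← h.apply_symm_apply (g x), key]

theorem exists_moved_on_sphere (hconn : G.Connected)
    (hlf : ∀ x : V, (G.neighborSet x).Finite) (hmot : InfiniteMotion G) {v : V} {i k : ℕ}
    (hki : k < i) (g : G ≃g G) (hg : G.dist v (g v) ≤ k) {x : V} (hx : G.dist v x ≤ k)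
    (hne : g x ≠ x) : ∃ y, G.dist v y = i ∧ g y ≠ y := by
  by_contra! hcon
  exact hne (fixes_ball_of_fixes_sphere hconn hlf hmot g (by omega) hcon (by omega))

end Motion

section Counting

open Finset

theorem card_biUnion_mul_le {ι α : Type*} [DecidableEq α] (s : Finset ι) (f : ι → Finset α)
    (b c : ℕ) (h : ∀ i ∈ s, #(f i) * c ≤ b) : #(s.biUnion f) * c ≤ #s * b := by
  calc #(s.biUnion f) * c ≤ (∑ i ∈ s, #(f i)) * c := Nat.mul_le_mul_right _ card_biUnion_le
    _ = ∑ i ∈ s, #(f i) * c := sum_mul _ _ _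
    _ ≤ #s * b := by simpa using sum_le_card_nsmul s _ b h

theorem exists_disjoint_image {V : Type*} [DecidableEq V] {g : V → V}
    (hg : Function.Injective g) (M : Finset V) (hM : ∀ u ∈ M, g u ≠ u) :
    ∃ D ⊆ M, (∀ u ∈ D, g u ∉ D) ∧ #M ≤ 3 * #D := by
  obtain ⟨D, hD, hmax⟩ := exists_max_image (M.powerset.filter fun D => ∀ u ∈ D, g u ∉ D) card
    ⟨∅, by simp⟩
  rw [mem_filter, mem_powerset] at hD
  refine ⟨D, hD.1, hD.2, ?_⟩
  have hcover : M ⊆ (D ∪ D.image g) ∪ D.preimage g hg.injOn := by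
    intro u hu
    by_contra hnot
    simp only [mem_union, mem_image, mem_preimage, not_or, not_exists, not_and] at hnot
    obtain ⟨⟨h1, h2⟩, h3⟩ := hnot
    have := hmax (insert u D) (by
      simp only [mem_filter, mem_powerset, insert_subset_iff, mem_insert, forall_eq_or_imp,
        not_or]
      exact ⟨⟨hu, hD.1⟩, ⟨hM u hu, h3⟩, fun a ha => ⟨h2 a ha, hD.2 a ha⟩⟩)
    rw [card_insert_of_notMem h1] at this
    omega
  have h1 := card_le_card hcover
  have h2 := card_union_le (D ∪ D.image g) (D.preimage g hg.injOn)
  have h3 := card_union_le D (D.image g)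
  have h4 : #(D.image g) ≤ #D := card_image_le
  have h5 : #(D.preimage g hg.injOn) ≤ #D :=
    card_le_card_of_injOn g (fun u hu => by simpa using hu) hg.injOn
  omega

theorem card_invariant_subsets_mul_le {V : Type*} [DecidableEq V] {g : V → V}
    (hg : Function.Injective g) {A M : Finset V} (hMA : M ⊆ A) (hM : ∀ u ∈ M, g u ≠ u)
    {d : ℕ} (hd : 3 * d ≤ #M) :
    #{S ∈ A.powerset | ∀ u ∈ M, (g u ∈ S ↔ u ∈ S)} * 2 ^ d ≤ 2 ^ #A := by
  obtain ⟨D, hDM, hD, hcard⟩ := exists_disjoint_image hg M hM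
  have hle : #{S ∈ A.powerset | ∀ u ∈ M, (g u ∈ S ↔ u ∈ S)} ≤ #(A \ D).powerset := by
    refine card_le_card_of_injOn (fun S => S \ D) (fun S hS => ?_) ?_
    · rw [mem_coe, mem_filter, mem_powerset] at hS
      exact mem_coe.2 (mem_powerset.2 (sdiff_subset_sdiff hS.1 le_rfl))
    · intro S hS T hT hST
      rw [mem_coe, mem_filter] at hS hT
      have hout : ∀ u, u ∉ D → (u ∈ S ↔ u ∈ T) := fun u hu => by
        simpa [hu] using Finset.ext_iff.1 hST u
      ext u
      by_cases hu : u ∈ D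
      · rw [← hS.2 u (hDM hu), ← hT.2 u (hDM hu)]
        exact hout _ (hD u hu)
      · exact hout u hu
  rw [card_powerset] at hle
  calc _ ≤ 2 ^ #(A \ D) * 2 ^ #D :=
        Nat.mul_le_mul hle (Nat.pow_le_pow_right two_pos (by omega))
    _ = 2 ^ #A := by rw [← pow_add, card_sdiff_add_card_eq_card (hDM.trans hMA)]

theorem exists_mul_le_sum_range (κ : ℕ → ℕ) {C r : ℕ} (hC : 0 < C) (h0 : 1 ≤ κ 0)
    (hsum : ∑ t ∈ range (1 + C * r), κ t < 2 ^ r) :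
    ∃ j < 1 + C * r, C * κ j ≤ ∑ t ∈ range (j + 1), κ t := by
  by_contra! hcon
  refine hsum.not_ge ?_
  clear hsum
  induction r with
  | zero => simpa using h0
  | succ r ih =>
    have ih := ih fun j hj => hcon j (by rw [Nat.mul_succ]; omega)
    set T := ∑ t ∈ range (1 + C * r), κ t with hT
    have hterm : ∀ s ∈ range C, T ≤ C * κ (1 + C * r + s) := by
      intro s hs
      rw [mem_range] at hs
      refine le_trans ?_ (hcon (1 + C * r + s) (by rw [Nat.mul_succ]; omega)).le
      exact sum_le_sum_of_subset (range_subset_range.2 (by omega))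
    have hnew : T ≤ ∑ s ∈ range C, κ (1 + C * r + s) := by
      refine Nat.le_of_mul_le_mul_left ?_ hC
      have := card_nsmul_le_sum _ _ _ hterm
      rwa [card_range, smul_eq_mul, ← mul_sum] at this
    rw [Nat.mul_succ, ← add_assoc, sum_range_add, ← hT, pow_succ]
    omega

end Counting

section Growth

theorem exists_mul_cube_le_two_pow (c : ℕ) : ∃ t : ℕ, 1 ≤ t ∧ c * t ^ 3 ≤ 2 ^ t := by
  have h := (tendsto_pow_const_div_const_pow_of_one_lt 3 (one_lt_two (α := ℝ))).eventually
    (gt_mem_nhds (show (0 : ℝ) < 1 / (c + 1) by positivity))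
  obtain ⟨t, ht, ht1⟩ := (h.and (eventually_ge_atTop 1)).exists
  refine ⟨t, ht1, ?_⟩
  rw [div_lt_div_iff₀ (by positivity) (by positivity)] at ht
  have : (t : ℝ) ^ 3 * (c + 1) < 2 ^ t := by simpa using ht
  have h' : t ^ 3 * (c + 1) < 2 ^ t := by exact_mod_cast this
  nlinarith [Nat.zero_le (t ^ 3)]

theorem exists_slow_growth_window {β : ℕ → ℕ} (hmono : Monotone β) (hpos : ∀ n, 0 < β n)
    {n₀ : ℕ} (hquad : ∀ n ≥ n₀, β n ≤ n ^ 2) {k : ℕ} (hk : 0 < k) (m : ℕ) :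
    ∃ n L : ℕ, m + k ≤ n ∧ 1 ≤ L ∧ β (n + (1 + 15 * L * (L + 1)) + k) ≤ 2 ^ L ∧
      k * β (n + (1 + 15 * L * (L + 1))) ≤ k * β n + β (n - k) := by
  obtain ⟨t, ht1, ht⟩ := exists_mul_cube_le_two_pow (m + n₀ + 3 * k * (2 * k + 91))
  set w := 2 * k + (1 + 15 * (2 * t) * (2 * t + 1)) with hw
  have htop : m + n₀ + (2 * t + 1) * k * w ≤ 2 ^ t := by
    refine le_trans ?_ ht
    have h3 : 1 ≤ t ^ 3 := Nat.one_le_pow _ _ ht1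
    have ht2 : t ≤ t ^ 2 := Nat.le_self_pow two_ne_zero t
    have hw' : w ≤ (2 * k + 91) * t ^ 2 := by
      rw [hw]
      nlinarith [Nat.zero_le k]
    calc m + n₀ + (2 * t + 1) * k * w
        ≤ (m + n₀) * t ^ 3 + (3 * t) * k * ((2 * k + 91) * t ^ 2) := by
          gcongr
          · exact Nat.le_mul_of_pos_right _ h3
          · omega
      _ = _ := by ring
  by_contra! hcon
  have hbound : ∀ q ≤ (2 * t + 1) * k, β (m + q * w) ≤ 2 ^ (2 * t) := by
    intro q hq
    calc β (m + q * w) ≤ β (2 ^ t) := hmono (by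
          have := Nat.mul_le_mul_right w hq
          omega)
      _ ≤ (2 ^ t) ^ 2 := hquad _ (by omega)
      _ = 2 ^ (2 * t) := by rw [← pow_mul, mul_comm]
  have hk' : (0 : ℝ) < k := by exact_mod_cast hk
  have hgrow : ∀ q ≤ (2 * t + 1) * k, (1 + 1 / (k : ℝ)) ^ q ≤ β (m + q * w) := by
    intro q
    induction q with
    | zero =>
      intro _
      have := Nat.one_le_cast (α := ℝ).2 (hpos m)
      simpa using this
    | succ q ih =>
      intro hq
      have ih := ih (by omega)
      have hend : m + q * w + k + (1 + 15 * (2 * t) * (2 * t + 1)) + k = m + (q + 1) * w := by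
        rw [hw]; ring
      have hstep := hcon (m + q * w + k) (2 * t) (by omega) (by omega)
        (by rw [hend]; exact hbound _ hq)
      rw [Nat.add_sub_cancel] at hstep
      have h1 : β (m + q * w) ≤ β (m + q * w + k) := hmono (by omega)
      have h2 : β (m + q * w + k + (1 + 15 * (2 * t) * (2 * t + 1))) ≤ β (m + (q + 1) * w) :=
        hmono (by omega)
      have h3 : (k + 1) * β (m + q * w) ≤ k * β (m + (q + 1) * w) := by nlinarith
      have h4 : ((k : ℝ) + 1) * β (m + q * w) ≤ k * β (m + (q + 1) * w) := by
        exact_mod_cast h3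
      calc (1 + 1 / (k : ℝ)) ^ (q + 1) ≤ β (m + q * w) * (1 + 1 / (k : ℝ)) := by
            rw [pow_succ]
            gcongr
        _ = ((k : ℝ) + 1) * β (m + q * w) / k := by field_simp
        _ ≤ _ := by
            rw [div_le_iff₀ hk']
            linarith
  have hdouble : (2 : ℝ) ≤ (1 + 1 / (k : ℝ)) ^ k := by
    have := one_add_mul_le_pow (a := 1 / (k : ℝ)) (by
      have : (0 : ℝ) ≤ 1 / k := by positivity
      linarith) k
    rw [mul_one_div_cancel hk'.ne'] at this
    linarith
  have hlow : (2 : ℝ) ^ (2 * t + 1) ≤ β (m + (2 * t + 1) * k * w) := by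
    refine le_trans ?_ (hgrow _ le_rfl)
    rw [mul_comm (2 * t + 1) k, pow_mul]
    gcongr
  have hlow : 2 ^ (2 * t + 1) ≤ β (m + (2 * t + 1) * k * w) := by exact_mod_cast hlow
  have := hlow.trans (hbound _ le_rfl)
  rw [pow_succ] at this
  have : 0 < 2 ^ (2 * t) := by positivity
  omega

end Growth

section Annulus

variable {V : Type*} {G : SimpleGraph V}

open Finset

theorem eq_on_sphere_of_image_eq [DecidableEq V] {v : V} {i : ℕ} {g h : V → V} {s t : Finset V}
    (hs : ∀ u, u ∈ s ↔ G.dist v u = i ∧ g u ≠ u) (ht : ∀ u, u ∈ t ↔ G.dist v u = i ∧ h u ≠ u)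
    (heq : s.image (fun u => (u, g u)) = t.image fun u => (u, h u)) :
    ∀ u ∈ gsphere G v i, g u = h u := by
  intro u hu
  by_cases hgu : g u = u
  · by_contra hne
    have hmem : (u, h u) ∈ s.image fun u => (u, g u) := by
      rw [heq]
      exact mem_image_of_mem _ ((ht u).2 ⟨hu, fun h' => hne (hgu.trans h'.symm)⟩)
    obtain ⟨a, -, ha⟩ := mem_image.1 hmem
    rw [Prod.mk.injEq] at ha
    exact hne (ha.1 ▸ ha.2)
  · have hmem : (u, g u) ∈ t.image fun u => (u, h u) := by
      rw [← heq]
      exact mem_image_of_mem _ ((hs u).2 ⟨hu, hgu⟩)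
    obtain ⟨a, -, ha⟩ := mem_image.1 hmem
    rw [Prod.mk.injEq] at ha
    exact (ha.1 ▸ ha.2).symm

/-- `S` breaks inside the annulus `n < dist v u ≤ N` every automorphism that moves `v` by at most
`k` and moves some vertex of the ball of radius `k`. -/
def BreaksInAnnulus (G : SimpleGraph V) (v : V) (k n N : ℕ) (S : Set V) : Prop :=
  ∀ g : G ≃g G, G.dist v (g v) ≤ k → (∃ x, G.dist v x ≤ k ∧ g x ≠ x) →
    ∃ u, (n < G.dist v u ∧ G.dist v u ≤ N) ∧ ¬ (g u ∈ S ↔ u ∈ S)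

open Classical in
theorem exists_breaksInAnnulus [Infinite V] (hconn : G.Connected)
    (hlf : ∀ x : V, (G.neighborSet x).Finite) (hmot : InfiniteMotion G) (v : V) {k n L : ℕ}
    (hkn : 2 * k ≤ n) (hL : 1 ≤ L)
    (hβ : (gball G v (n + (1 + 15 * L * (L + 1)) + k)).ncard ≤ 2 ^ L) :
    ∃ S : Set V, (∀ x ∈ S, n < G.dist v x ∧ G.dist v x ≤ n + (1 + 15 * L * (L + 1))) ∧
      BreaksInAnnulus G v k n (n + (1 + 15 * L * (L + 1))) S := by
  set J := 1 + 15 * L * (L + 1) with hJ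
  set P : Finset V := (finite_gball hconn hlf v (n + J + k)).toFinset with hP
  have memP : ∀ x, x ∈ P ↔ G.dist v x ≤ n + J + k := fun x => by simp [hP, gball]
  have cardP : #P ≤ 2 ^ L := by rwa [hP, ← Set.ncard_eq_toFinset_card _ (finite_gball hconn hlf v (n + J + k))]
  have hJle : J ≤ 2 ^ L := by
    have := ncard_gball_lt hconn hlf v (n + J + k)
    omega
  set A : Finset V := P.filter fun x => n < G.dist v x ∧ G.dist v x ≤ n + J with hA
  have memA : ∀ x, x ∈ A ↔ n < G.dist v x ∧ G.dist v x ≤ n + J := fun x => by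
    rw [hA, mem_filter, memP]
    exact ⟨fun h => h.2, fun h => ⟨by omega, h⟩⟩
  let moved : (G ≃g G) → ℕ → Finset V := fun g j =>
    P.filter fun x => G.dist v x = n + 1 + j ∧ g x ≠ x
  have memMoved : ∀ g : G ≃g G, ∀ j < J, ∀ x,
      x ∈ moved g j ↔ G.dist v x = n + 1 + j ∧ g x ≠ x := fun g j hj x => by
    simp only [moved, mem_filter, memP]
    exact ⟨fun h => h.2, fun h => ⟨by omega, h⟩⟩
  let relevant : (G ≃g G) → Prop := fun g =>
    G.dist v (g v) ≤ k ∧ ∃ x, G.dist v x ≤ k ∧ g x ≠ x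
  let code : (G ≃g G) → ℕ → Finset (V × V) := fun g j => (moved g j).image fun u => (u, g u)
  let bad : ℕ → ℕ → Finset (V × V) → Finset (Finset V) := fun j K E =>
    A.powerset.filter fun S => ∃ g, relevant g ∧ code g j = E ∧
      15 * L * K ≤ ∑ t ∈ range (j + 1), #(moved g t) ∧ ∀ u ∈ A, (g u ∈ S ↔ u ∈ S)
  have sum_moved : ∀ g, ∀ j ≤ J, ∑ t ∈ range j, #(moved g t) =
      #((range j).biUnion (moved g)) := fun g j hj => by
    refine (card_biUnion fun a ha b hb hab => ?_).symm
    rw [mem_coe, mem_range] at ha hb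
    refine Finset.disjoint_left.2 fun x hx hx' => hab ?_
    rw [memMoved g _ (by omega)] at hx hx'
    omega
  have card_bad : ∀ j < J, ∀ K E, #(bad j K E) * 2 ^ (5 * L * K) ≤ 2 ^ #A := by
    intro j hj K E
    rcases (bad j K E).eq_empty_or_nonempty with h | ⟨S₀, hS₀⟩
    · simp [h]
    obtain ⟨-, g, ⟨hg, -⟩, hcode, hsum, -⟩ := mem_filter.1 hS₀
    rw [sum_moved g _ hj] at hsum
    have hMA : (range (j + 1)).biUnion (moved g) ⊆ A := by
      intro x hx
      obtain ⟨t, ht, hx⟩ := mem_biUnion.1 hx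
      rw [mem_range] at ht
      rw [memMoved g t (by omega)] at hx
      rw [memA]
      omega
    have hM : ∀ u ∈ (range (j + 1)).biUnion (moved g), g u ≠ u := by
      intro x hx
      obtain ⟨t, ht, hx⟩ := mem_biUnion.1 hx
      exact (mem_filter.1 hx).2.2
    refine le_trans (Nat.mul_le_mul_right _ (card_le_card fun S hS => ?_))
      (card_invariant_subsets_mul_le g.injective hMA hM (d := 5 * L * K) (by linarith))
    obtain ⟨hSA, h, ⟨hh, -⟩, hcode', -, hinv⟩ := mem_filter.1 hS
    refine mem_filter.2 ⟨hSA, fun u hu => ?_⟩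
    have hagree : g u = h u := by
      refine eq_on_ball_of_eq_on_sphere hconn hlf hmot (v := v) (i := n + 1 + j) (k := k)
        (by omega) g h hg hh ?_ ?_
      · exact eq_on_sphere_of_image_eq (memMoved g j hj) (memMoved h j hj)
          (hcode.trans hcode'.symm)
      · obtain ⟨t, ht, hu⟩ := mem_biUnion.1 hu
        rw [mem_range] at ht
        rw [memMoved g t (by omega)] at hu
        omega
    rw [hagree]
    exact hinv u (hMA hu)
  have card_codes : ∀ j < J, ∀ K ∈ Icc 1 (2 ^ L),
      #((powersetCard K (P ×ˢ P)).biUnion (bad j K)) * 2 ^ (3 * L) ≤ 2 ^ #A := by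
    intro j hj K hK
    rw [mem_Icc] at hK
    have h1 := card_biUnion_mul_le (powersetCard K (P ×ˢ P)) (bad j K) _ _
      fun E _ => card_bad j hj K E
    have h2 : #(powersetCard K (P ×ˢ P)) ≤ 2 ^ (2 * L * K) := by
      rw [card_powersetCard, card_product]
      calc (#P * #P).choose K ≤ (#P * #P) ^ K := Nat.choose_le_pow _ _
        _ ≤ (2 ^ L * 2 ^ L) ^ K := by gcongr
        _ = 2 ^ (2 * L * K) := by rw [← pow_add, ← two_mul, ← pow_mul]
    have h3 : 2 ^ (5 * L * K) = 2 ^ (3 * L * K) * 2 ^ (2 * L * K) := by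
      rw [← pow_add]
      ring_nf
    have h4 := h1.trans (Nat.mul_le_mul_right _ h2)
    rw [h3, ← mul_assoc, mul_comm (2 ^ (2 * L * K)) (2 ^ #A)] at h4
    refine le_trans (Nat.mul_le_mul_left _ (Nat.pow_le_pow_right two_pos ?_))
      (Nat.le_of_mul_le_mul_right h4 (by positivity))
    exact Nat.le_mul_of_pos_right _ hK.1
  have card_sizes : ∀ j ∈ range J,
      #((Icc 1 (2 ^ L)).biUnion fun K => (powersetCard K (P ×ˢ P)).biUnion (bad j K)) *
        2 ^ (3 * L) ≤ 2 ^ L * 2 ^ #A := by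
    intro j hj
    refine (card_biUnion_mul_le _ _ _ _ (card_codes j (mem_range.1 hj))).trans ?_
    simp
  have card_all := card_biUnion_mul_le _ _ _ _ card_sizes
  rw [card_range] at card_all
  set allBad := (range J).biUnion fun j => (Icc 1 (2 ^ L)).biUnion fun K =>
    (powersetCard K (P ×ˢ P)).biUnion (bad j K) with hallBad
  have card_lt : #allBad < #A.powerset := by
    rw [card_powerset]
    have h1 : #allBad * 2 ^ L * (2 ^ L * 2 ^ L) ≤ 2 ^ #A * (2 ^ L * 2 ^ L) := by
      calc #allBad * 2 ^ L * (2 ^ L * 2 ^ L) = #allBad * 2 ^ (3 * L) := by ring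
        _ ≤ J * (2 ^ L * 2 ^ #A) := card_all
        _ ≤ 2 ^ L * (2 ^ L * 2 ^ #A) := Nat.mul_le_mul_right _ hJle
        _ = _ := by ring
    have h2 := Nat.le_of_mul_le_mul_right h1 (by positivity)
    have h3 : 2 ≤ 2 ^ L := Nat.le_self_pow (by omega) 2
    have h4 : 0 < 2 ^ #A := by positivity
    nlinarith
  obtain ⟨S, hSA, hS⟩ := exists_mem_notMem_of_card_lt_card card_lt
  refine ⟨S, fun x hx => (memA x).1 (mem_powerset.1 hSA hx), fun g hg hx => ?_⟩
  by_contra! hinv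
  refine hS ?_
  have moved_pos : ∀ j < J, 1 ≤ #(moved g j) := by
    intro j hj
    obtain ⟨x, hxk, hne⟩ := hx
    obtain ⟨y, hy, hgy⟩ := exists_moved_on_sphere hconn hlf hmot
      (show k < n + 1 + j by omega) g hg hxk hne
    exact card_pos.2 ⟨y, (memMoved g j hj y).2 ⟨hy, hgy⟩⟩
  have hsum : ∑ t ∈ range J, #(moved g t) < 2 ^ (L + 1) := by
    rw [sum_moved g J le_rfl]
    refine (card_le_card (biUnion_subset.2 fun t _ => filter_subset _ _)).trans_lt
      (cardP.trans_lt (Nat.pow_lt_pow_right one_lt_two L.lt_succ_self))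
  obtain ⟨j, hj, hjsum⟩ := exists_mul_le_sum_range (fun t => #(moved g t))
    (C := 15 * L) (r := L + 1) (by omega) (moved_pos 0 (by omega)) hsum
  have hjJ : j < J := hj
  have hcode : #(code g j) = #(moved g j) :=
    card_image_of_injective _ fun a b hab => (Prod.mk.inj hab).1
  refine mem_biUnion.2 ⟨j, mem_range.2 hjJ, mem_biUnion.2 ⟨#(moved g j), mem_Icc.2
    ⟨moved_pos j hjJ, (card_le_card (filter_subset _ _)).trans cardP⟩,
    mem_biUnion.2 ⟨code g j, mem_powersetCard.2 ⟨?_, hcode⟩, mem_filter.2 ⟨hSA, g,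
      ⟨hg, hx⟩, rfl, hjsum, fun u hu => hinv u ((memA u).1 hu)⟩⟩⟩⟩
  intro p hp
  obtain ⟨u, hu, rfl⟩ := mem_image.1 hp
  rw [memMoved g j hjJ] at hu
  refine mem_product.2 ⟨(memP u).2 (by omega), (memP (g u)).2 ?_⟩
  have htri := hconn.dist_triangle (u := v) (v := g v) (w := g u)
  rw [dist_iso hconn] at htri
  omega

end Annulus

section Assembly

variable {V : Type*} {G : SimpleGraph V}

theorem eventually_ncard_gball_le_sq {v : V}
    (h : Tendsto (fun n : ℕ => ((gball G v n).ncard : ℝ) / (n : ℝ) ^ 2) atTop (nhds 0)) :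
    ∃ n₀, ∀ n ≥ n₀, (gball G v n).ncard ≤ n ^ 2 := by
  obtain ⟨n₀, hn₀⟩ := eventually_atTop.1
    ((h.eventually (gt_mem_nhds one_pos)).and (eventually_gt_atTop 0))
  refine ⟨n₀, fun n hn => ?_⟩
  obtain ⟨h1, hpos⟩ := hn₀ n hn
  have hpos : (0 : ℝ) < (n : ℝ) ^ 2 := by positivity
  rw [div_lt_one hpos] at h1
  exact_mod_cast h1.le

theorem exists_sparse_block [Infinite V] (hconn : G.Connected)
    (hlf : ∀ x : V, (G.neighborSet x).Finite) (hmot : InfiniteMotion G) (v : V) {n₀ : ℕ}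
    (hquad : ∀ n ≥ n₀, (gball G v n).ncard ≤ n ^ 2) {k : ℕ} (hk : 0 < k) (m : ℕ) :
    ∃ (n N : ℕ) (S : Set V), m + k ≤ n ∧ n < N ∧ (∀ x ∈ S, n < G.dist v x ∧ G.dist v x ≤ N) ∧
      k * (gball G v N).ncard ≤ k * (gball G v n).ncard + (gball G v (n - k)).ncard ∧
      BreaksInAnnulus G v k n N S := by
  obtain ⟨n, L, hn, hL, hβ, hsparse⟩ := exists_slow_growth_window (ncard_gball_mono hconn hlf v)
    (fun n => n.zero_le.trans_lt (ncard_gball_lt hconn hlf v n)) hquad hk (m + k)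
  obtain ⟨S, hS, hbreak⟩ :=
    exists_breaksInAnnulus hconn hlf hmot v (k := k) (by omega) hL hβ
  exact ⟨n, _, S, by omega, by omega, hS, hsparse, hbreak⟩

theorem exists_block_sequence [Infinite V] (hconn : G.Connected)
    (hlf : ∀ x : V, (G.neighborSet x).Finite) (hmot : InfiniteMotion G) (v : V) {n₀ : ℕ}
    (hquad : ∀ n ≥ n₀, (gball G v n).ncard ≤ n ^ 2) :
    ∃ (n N : ℕ → ℕ) (S : ℕ → Set V), ∀ s,
      n s < N s ∧ (∀ x ∈ S s, n s < G.dist v x ∧ G.dist v x ≤ N s) ∧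
      (s + 1) * (gball G v (N s)).ncard ≤
        (s + 1) * (gball G v (n s)).ncard + (gball G v (n s - (s + 1))).ncard ∧
      BreaksInAnnulus G v (s + 1) (n s) (N s) (S s) ∧
      N s + 2 * (s + 2) ≤ n (s + 1) ∧
      (s + 2) * (gball G v (N s)).ncard ≤ (gball G v (n (s + 1) - (s + 2))).ncard := by
  choose n N S hm hlt hS hsparse hbreak using fun (s m : ℕ) =>
    exists_sparse_block hconn hlf hmot v hquad s.succ_pos m
  obtain ⟨m, hrec⟩ : ∃ m : ℕ → ℕ, ∀ s, m (s + 1) =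
      N s (m s) + 2 * (s + 2) + (s + 2) * (gball G v (N s (m s))).ncard :=
    ⟨fun s => Nat.rec 0 (fun s x => N s x + 2 * (s + 2) +
      (s + 2) * (gball G v (N s x)).ncard) s, fun _ => rfl⟩
  refine ⟨fun s => n s (m s), fun s => N s (m s), fun s => S s (m s), fun s =>
    ⟨hlt _ _, hS _ _, hsparse _ _, hbreak _ _, ?_, ?_⟩⟩
  · beta_reduce
    have := hm (s + 1) (m (s + 1))
    have := hrec s
    omega
  · beta_reduce
    have h1 := hm (s + 1) (m (s + 1))
    have h2 := hrec s
    have h3 := ncard_gball_lt hconn hlf v (n (s + 1) (m (s + 1)) - (s + 2))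
    omega

theorem exists_between_of_strictMono {a : ℕ → ℕ} (ha : StrictMono a) {s₀ m : ℕ}
    (h : a s₀ ≤ m) : ∃ s, s₀ ≤ s ∧ a s ≤ m ∧ m < a (s + 1) := by
  have hs₀ : s₀ ≤ m := (ha.le_apply).trans h
  refine ⟨Nat.findGreatest (fun s => a s ≤ m) m, Nat.le_findGreatest hs₀ h,
    Nat.findGreatest_spec (P := fun s => a s ≤ m) hs₀ h, ?_⟩
  by_contra! hle
  have := Nat.le_findGreatest (P := fun s => a s ≤ m) ((ha.le_apply).trans hle) hle
  omega

theorem densityZeroAt_iUnion_blocks [Infinite V] (hconn : G.Connected)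
    (hlf : ∀ x : V, (G.neighborSet x).Finite) (v : V) {n N : ℕ → ℕ} {S : ℕ → Set V}
    (hlt : ∀ s, n s < N s) (hS : ∀ s, ∀ x ∈ S s, n s < G.dist v x ∧ G.dist v x ≤ N s)
    (hsparse : ∀ s, (s + 1) * (gball G v (N s)).ncard ≤
      (s + 1) * (gball G v (n s)).ncard + (gball G v (n s - (s + 1))).ncard)
    (hgap : ∀ s, N s + 2 * (s + 2) ≤ n (s + 1))
    (hsmall : ∀ s, (s + 2) * (gball G v (N s)).ncard ≤
      (gball G v (n (s + 1) - (s + 2))).ncard) (x : V) :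
    DensityZeroAt G (⋃ s, S s) x := by
  have hn : StrictMono n := strictMono_nat_of_lt_succ fun s => by
    have := hlt s
    have := hgap s
    omega
  have hN : Monotone N := monotone_nat_of_le_succ fun s => by
    have := hlt (s + 1)
    have := hgap s
    omega
  set d := G.dist v x with hd
  have key : ∀ p r : ℕ, 2 * d ≤ p → n (p + 1) ≤ r + d → r + d < n (p + 2) →
      (p + 2) * (gball G x r ∩ ⋃ s, S s).ncard ≤ 2 * (gball G x r).ncard := by
    intro p r hp hle hlt'
    have hsub : (gball G x r ∩ ⋃ s, S s) ⊆
        gball G v (N p) ∪ (gball G v (N (p + 1)) \ gball G v (n (p + 1))) := by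
      rintro y ⟨hy, hyS⟩
      obtain ⟨s, hys⟩ := Set.mem_iUnion.1 hyS
      obtain ⟨h1, h2⟩ := hS s y hys
      have hy : G.dist x y ≤ r := hy
      have htri := hconn.dist_triangle (u := v) (v := x) (w := y)
      have hs : s < p + 2 := hn.lt_iff_lt.1 (by omega)
      rcases Nat.lt_succ_iff_lt_or_eq.1 hs with h | rfl
      · exact Or.inl (h2.trans (hN (Nat.lt_succ_iff.1 h)))
      · exact Or.inr ⟨h2, not_le.2 h1⟩
    have hcount := (Set.ncard_le_ncard hsub
      ((finite_gball hconn hlf v _).union ((finite_gball hconn hlf v _).sdiff))).trans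
      (Set.ncard_union_le _ _)
    have hmono := ncard_gball_mono hconn hlf v
    have hdiff := Set.ncard_sdiff_add_ncard_of_subset
      (s := gball G v (n (p + 1))) (t := gball G v (N (p + 1)))
      (fun y (hy : G.dist v y ≤ _) => hy.trans (hlt (p + 1)).le) (finite_gball hconn hlf v _)
    have hinner : (gball G v (n (p + 1) - (p + 2))).ncard ≤ (gball G x r).ncard := by
      refine Set.ncard_le_ncard (fun y hy => ?_) (finite_gball hconn hlf x r)
      have hy : G.dist v y ≤ n (p + 1) - (p + 2) := hy
      have htri := hconn.dist_triangle (u := x) (v := v) (w := y)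
      rw [dist_comm (u := x) (v := v), ← hd] at htri
      have := hgap p
      change G.dist x y ≤ r
      omega
    have h1 := hsparse (p + 1)
    have h2 := hsmall p
    have h3 := Nat.mul_le_mul_left (p + 2) hcount
    rw [← hdiff] at h1
    rw [mul_add] at h1 h3
    simp only [add_assoc, Nat.reduceAdd] at h1
    omega
  rw [DensityZeroAt, Metric.tendsto_atTop]
  intro ε hε
  obtain ⟨q, hq⟩ := exists_nat_gt (2 / ε)
  refine ⟨n (q + 2 * d + 1), fun r hr => ?_⟩
  obtain ⟨s, hs, hle, hlt'⟩ := exists_between_of_strictMono hn (hr.trans (r.le_add_right d))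
  obtain ⟨p, rfl⟩ : ∃ p, s = p + 1 := ⟨s - 1, by omega⟩
  have hkey := key p r (by omega) hle hlt'
  have hpos : (0 : ℝ) < (gball G x r).ncard :=
    Nat.cast_pos.2 (r.zero_le.trans_lt (ncard_gball_lt hconn hlf x r))
  have hkey' : ((p : ℝ) + 2) * (gball G x r ∩ ⋃ s, S s).ncard ≤ 2 * (gball G x r).ncard := by
    exact_mod_cast hkey
  rw [Real.dist_0_eq_abs, abs_of_nonneg (by positivity), div_lt_iff₀ hpos]
  have hqp : (q : ℝ) ≤ p := by exact_mod_cast (by omega : q ≤ p)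
  have hε2 : 2 < ε * ((p : ℝ) + 2) := by
    rw [div_lt_iff₀ hε] at hq
    nlinarith
  have hp2 : (0 : ℝ) < (p : ℝ) + 2 := by positivity
  refine lt_of_mul_lt_mul_left (lt_of_le_of_lt hkey' ?_) hp2.le
  nlinarith

theorem distinguishing_iUnion_blocks (hconn : G.Connected) (v : V) {n N : ℕ → ℕ}
    {S : ℕ → Set V} (hlt : ∀ s, n s < N s)
    (hS : ∀ s, ∀ x ∈ S s, n s < G.dist v x ∧ G.dist v x ≤ N s)
    (hbreak : ∀ s, BreaksInAnnulus G v (s + 1) (n s) (N s) (S s))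
    (hgap : ∀ s, N s + 2 * (s + 2) ≤ n (s + 1)) (g : G ≃g G)
    (hg : ∀ x, g x ∈ ⋃ s, S s ↔ x ∈ ⋃ s, S s) (x : V) : g x = x := by
  have hN : Monotone N := monotone_nat_of_le_succ fun s => by
    have := hlt (s + 1)
    have := hgap s
    omega
  have hsep : ∀ s t, s < t → N s + 2 * (t + 1) ≤ n t := by
    intro s t hst
    obtain ⟨t, rfl⟩ : ∃ t', t = t' + 1 := ⟨t - 1, by omega⟩
    have := hgap t
    have := hN (Nat.lt_succ_iff.1 hst)
    omega
  have hlocal : ∀ s y, n s < G.dist v y + (s + 1) → G.dist v y ≤ N s + (s + 1) →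
      (y ∈ ⋃ s, S s ↔ y ∈ S s) := by
    refine fun s y h1 h2 => ⟨fun hy => ?_, fun hy => Set.mem_iUnion.2 ⟨s, hy⟩⟩
    obtain ⟨t, ht⟩ := Set.mem_iUnion.1 hy
    have := hS t y ht
    rcases lt_trichotomy s t with h | rfl | h
    · have := hsep s t h
      omega
    · exact ht
    · have := hsep t s h
      omega
  by_contra hne
  set s := G.dist v x + G.dist v (g v) with hs
  obtain ⟨u, hu, hnot⟩ := hbreak s g (by omega) ⟨x, by omega, hne⟩
  refine hnot ?_
  have htri := hconn.dist_triangle (u := v) (v := g v) (w := g u)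
  have htri' := hconn.dist_triangle (u := g v) (v := v) (w := g u)
  rw [dist_iso hconn] at htri htri'
  rw [dist_comm (u := g v) (v := v)] at htri'
  rw [← hlocal s u (by omega) (by omega), ← hlocal s (g u) (by omega) (by omega)]
  exact hg u

end Assembly

/-- Let `G` be a connected, locally finite, infinite graph with
infinite motion and subquadratic growth (`|B_v(n)|/n² → 0` for some vertex `v`).
Then `G` admits a distinguishing 2-coloring one of whose color classes has density
zero at every vertex. -/
theorem stmt_16 {V : Type*} [Infinite V] (G : SimpleGraph V) (hconn : G.Connected)
    (hlf : ∀ x : V, (G.neighborSet x).Finite) (hmot : InfiniteMotion G)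
    (hgrowth : ∃ v : V, Tendsto
      (fun n : ℕ => ((gball G v n).ncard : ℝ) / (n : ℝ) ^ 2) atTop (nhds 0)) :
    ∃ l : V → Bool, Distinguishing G l ∧
      ∃ b : Bool, ∀ x : V, DensityZeroAt G {y | l y = b} x := by
  classical
  obtain ⟨v, hv⟩ := hgrowth
  obtain ⟨n₀, hquad⟩ := eventually_ncard_gball_le_sq hv
  obtain ⟨n, N, S, h⟩ := exists_block_sequence hconn hlf hmot v hquad
  refine ⟨fun x => decide (x ∈ ⋃ s, S s), fun g hg x => ?_, true, fun x => ?_⟩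
  · exact distinguishing_iUnion_blocks hconn v (fun s => (h s).1) (fun s => (h s).2.1)
      (fun s => (h s).2.2.2.1) (fun s => (h s).2.2.2.2.1) g
      (fun y => decide_eq_decide.1 (hg y)) x
  · simp only [decide_eq_true_eq]
    exact densityZeroAt_iUnion_blocks hconn hlf v (fun s => (h s).1) (fun s => (h s).2.1)
      (fun s => (h s).2.2.1) (fun s => (h s).2.2.2.2.1) (fun s => (h s).2.2.2.2.2) x
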